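/- arXiv:1301.0791 — 2 statements merged into one kernel-verified Lean document; each statement's English description precedes it below -/
import Mathlib

section
/- For every natural number k ≥ 2, there exists a weak mixing invertible measure-preserving transformation T of a standard probability space such that the sequence ρ_n = k^n (n ∈ ℕ) is a rigidity sequence for T. -/
open MeasureTheory Filter

/-- `T` is weak mixing for `μ`. -/
def WeakMixing {X : Type*} [MeasurableSpace X] (μ : Measure X) (T : X → X) : Prop :=
  ∀ A B : Set X, MeasurableSet A → MeasurableSet B →
    Tendsto (fun n : ℕ => (1 / (n : ℝ)) *
        ∑ i ∈ Finset.range n,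
          |(μ (T^[i] '' A ∩ B)).toReal - (μ A).toReal * (μ B).toReal|)
      atTop (nhds 0)

/-- `ρ` is a rigidity sequence for `T`. -/
def RigiditySeq {X : Type*} [MeasurableSpace X] (μ : Measure X) (T : X → X)
    (ρ : ℕ → ℕ) : Prop :=
  ∀ A : Set X, MeasurableSet A →
    Tendsto (fun n : ℕ => μ (symmDiff (T^[ρ n] '' A) A)) atTop (nhds 0)

open ProbabilityTheory Complex in
/-- For a sequence of vectors in a real inner product space, their coordinates along the
Gram-Schmidt system exhaust the norm. -/
theorem exists_square_sum_coordinates {H : Type*} [NormedAddCommGroup H] [InnerProductSpace ℝ H]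
    (v : ℕ → H) :
    ∃ c : ℕ → ℕ → ℝ, (∀ n j, n < j → c n j = 0) ∧
      ∀ (a : ℕ →₀ ℝ) (N : ℕ), a.support ⊆ Finset.range N →
      ‖Finsupp.linearCombination ℝ v a‖ ^ 2 =
        ∑ j ∈ Finset.range N, (∑ n ∈ Finset.range N, a n * c n j) ^ 2 := by
  set e := InnerProductSpace.gramSchmidtNormed ℝ v with he
  have hspan (w : H) (N : ℕ) (hw : w ∈ Submodule.span ℝ (e '' Set.Iio N)) :
      w = ∑ j ∈ Finset.range N, inner ℝ (e j) w • e j := by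
    induction hw using Submodule.span_induction with
    | mem x hx =>
      obtain ⟨i, hi, rfl⟩ := hx
      rw [Finset.sum_eq_single_of_mem i (Finset.mem_range.2 hi)]
      · by_cases h0 : e i = 0
        · simp [h0]
        · have := InnerProductSpace.gramSchmidtNormed_unit_length' (𝕜 := ℝ) h0
          rw [real_inner_self_eq_norm_sq, this]
          simp
      · intro j _ hji
        have : inner ℝ (e j) (e i) = 0 := by
          simp only [he, InnerProductSpace.gramSchmidtNormed, inner_smul_left, inner_smul_right,
            InnerProductSpace.gramSchmidt_orthogonal ℝ v hji, mul_zero]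
        rw [this, zero_smul]
    | zero => simp
    | add x y _ _ hx hy =>
      conv_lhs => rw [hx, hy]
      simp only [inner_add_right, add_smul, Finset.sum_add_distrib]
    | smul r x _ hx =>
      conv_lhs => rw [hx]
      simp only [inner_smul_right, Finset.smul_sum, smul_smul]
  refine ⟨fun n j => inner ℝ (e j) (v n), fun n j hnj => ?_, fun a N ha => ?_⟩
  · simp only [he, InnerProductSpace.gramSchmidtNormed, inner_smul_left,
      InnerProductSpace.gramSchmidt_inv_triangular ℝ v hnj, mul_zero]
  have hlin : Finsupp.linearCombination ℝ v a = ∑ n ∈ Finset.range N, a n • v n := by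
    rw [Finsupp.linearCombination_apply, Finsupp.sum_of_support_subset _ ha _ (by simp)]
  set w := Finsupp.linearCombination ℝ v a
  have hw : w ∈ Submodule.span ℝ (e '' Set.Iio N) := by
    rw [InnerProductSpace.span_gramSchmidtNormed, InnerProductSpace.span_gramSchmidt_Iio, hlin]
    exact Submodule.sum_mem _ fun n hn => Submodule.smul_mem _ _
      (Submodule.subset_span ⟨n, by simpa using hn, rfl⟩)
  have hc (j : ℕ) : ∑ n ∈ Finset.range N, a n * inner ℝ (e j) (v n) = inner ℝ (e j) w := by
    rw [hlin, inner_sum]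
    simp only [inner_smul_right]
  simp only [hc]
  rw [← real_inner_self_eq_norm_sq]
  conv_lhs => rw [hspan w N hw, sum_inner]
  refine Finset.sum_congr rfl fun j _ => ?_
  rw [inner_smul_left, ← hspan w N hw]
  simp [sq]

open ProbabilityTheory Complex in
/-- The characteristic functional of a finite combination of i.i.d. standard Gaussians. -/
theorem integral_exp_sum_infinitePi_gaussianReal (s : Finset ℕ) (b : ℕ → ℝ) :
    ∫ x, cexp ((∑ j ∈ s, b j * x j : ℝ) * I)
        ∂(Measure.infinitePi fun _ : ℕ => gaussianReal 0 1) =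
      (Real.exp (-(∑ j ∈ s, b j ^ 2) / 2) : ℂ) := by
  set P := Measure.infinitePi fun _ : ℕ => gaussianReal 0 1
  have hind : iIndepFun (fun (i : ℕ) (x : ℕ → ℝ) => b i * x i) P :=
    iIndepFun_infinitePi (Ω := fun _ => ℝ) (P := fun _ => gaussianReal 0 1)
      (X := fun i y => b i * y) (fun i => by fun_prop)
  have h := iIndepFun.charFun_map_fun_finsetSum_eq_prod (s := s)
    (X := fun (i : ℕ) (x : ℕ → ℝ) => b i * x i)
    (fun i _ => (show Measurable _ by fun_prop).aemeasurable) (hind.restrict s)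
  have h1 := congrFun h 1
  rw [charFun_apply_real, integral_map (show Measurable _ by fun_prop).aemeasurable
    (by fun_prop)] at h1
  simp only [ofReal_one, one_mul] at h1
  rw [h1, Finset.prod_apply]
  have hone (j : ℕ) : charFun (P.map fun x : ℕ → ℝ => b j * x j) 1
      = (Real.exp (-(b j ^ 2) / 2) : ℂ) := by
    have : P.map (fun x : ℕ → ℝ => b j * x j) = (gaussianReal 0 1).map (fun y => b j * y) := by
      rw [← Measure.infinitePi_map_eval (fun _ : ℕ => gaussianReal 0 1) j,
        Measure.map_map (by fun_prop) (by fun_prop)]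
      rfl
    rw [this, gaussianReal_map_const_mul, charFun_gaussianReal]
    push_cast
    congr 1
    simp
    ring
  simp only [hone]
  rw [← ofReal_prod, ← Real.exp_sum, ← Finset.sum_div, Finset.sum_neg_distrib]

theorem linearCombination_eq_equivMapDomain {R M ι κ : Type*} [Semiring R] [AddCommMonoid M]
    [Module R M] (φ : ι ≃ κ) (u : ι → M) (a : ι →₀ R) :
    Finsupp.linearCombination R u a =
      Finsupp.linearCombination R (u ∘ φ.symm) (a.equivMapDomain φ) := by
  rw [Finsupp.linearCombination_equivMapDomain, Function.comp_assoc, φ.symm_comp_self,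
    Function.comp_id]

open ProbabilityTheory Complex in
/-- Every countable family of vectors in a real inner product space is the covariance structure
of a centred Gaussian measure. -/
theorem exists_gaussian_measure {ι H : Type*} [Denumerable ι] [NormedAddCommGroup H]
    [InnerProductSpace ℝ H] (v : ι → H) :
    ∃ ν : Measure (ι → ℝ), IsProbabilityMeasure ν ∧ ∀ a : ι →₀ ℝ,
      ∫ x, cexp (Finsupp.linearCombination ℝ x a * I) ∂ν =
        (Real.exp (-‖Finsupp.linearCombination ℝ v a‖ ^ 2 / 2) : ℂ) := by
  let φ : ι ≃ ℕ := Denumerable.eqv ι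
  obtain ⟨c, hc0, hc⟩ := exists_square_sum_coordinates (v ∘ φ.symm)
  set P := Measure.infinitePi fun _ : ℕ => gaussianReal 0 1
  set F : (ℕ → ℝ) → ι → ℝ := fun y i => ∑ j ∈ Finset.range (φ i + 1), c (φ i) j * y j with hF
  have hFm : Measurable F := by fun_prop
  refine ⟨P.map F, Measure.isProbabilityMeasure_map hFm.aemeasurable, fun a => ?_⟩
  have hm : Measurable fun x : ι → ℝ => cexp (Finsupp.linearCombination ℝ x a * I) := by
    simp only [Finsupp.linearCombination_apply, Finsupp.sum]
    fun_prop
  rw [integral_map hFm.aemeasurable hm.aestronglyMeasurable]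
  set a' : ℕ →₀ ℝ := a.equivMapDomain φ
  obtain ⟨N, hN⟩ := a'.support.exists_nat_subset_range
  have hsum (y : ℕ → ℝ) : Finsupp.linearCombination ℝ (F y) a =
      ∑ j ∈ Finset.range N, (∑ n ∈ Finset.range N, a' n * c n j) * y j := by
    rw [linearCombination_eq_equivMapDomain φ, Finsupp.linearCombination_apply,
      Finsupp.sum_of_support_subset _ hN _ (by simp)]
    simp only [Finset.sum_mul]
    rw [Finset.sum_comm]
    refine Finset.sum_congr rfl fun n hn => ?_
    simp only [hF, Function.comp, Equiv.apply_symm_apply, smul_eq_mul, Finset.mul_sum, ← mul_assoc]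
    refine Finset.sum_subset (Finset.range_mono (by simpa using hn)) fun j _ hj => ?_
    rw [hc0 n j (by simpa using hj)]
    simp
  simp only [hsum]
  rw [integral_exp_sum_infinitePi_gaussianReal, linearCombination_eq_equivMapDomain φ, hc a' N hN]

/-- The character of `ι → ℝ` with frequency `a`. -/
noncomputable def piChar {ι : Type*} (a : ι →₀ ℝ) (x : ι → ℝ) : ℂ :=
  Complex.exp (Finsupp.linearCombination ℝ x a * Complex.I)

theorem continuous_piChar {ι : Type*} (a : ι →₀ ℝ) : Continuous (piChar a) := by
  unfold piChar
  simp only [Finsupp.linearCombination_apply, Finsupp.sum]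
  fun_prop

theorem norm_piChar {ι : Type*} (a : ι →₀ ℝ) (x : ι → ℝ) : ‖piChar a x‖ = 1 :=
  Complex.norm_exp_ofReal_mul_I _

theorem piChar_mul {ι : Type*} (a b : ι →₀ ℝ) (x : ι → ℝ) :
    piChar a x * piChar b x = piChar (a + b) x := by
  simp only [piChar, map_add, ← Complex.exp_add]
  push_cast
  ring_nf

theorem star_piChar {ι : Type*} (a : ι →₀ ℝ) (x : ι → ℝ) :
    (starRingEnd ℂ) (piChar a x) = piChar (-a) x := by
  simp only [piChar, map_neg, ← Complex.exp_conj, map_mul, Complex.conj_ofReal, Complex.conj_I]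
  push_cast
  ring_nf

/-- Finite measures on a countable power of `ℝ` are determined by their characteristic
functionals. -/
theorem ext_of_integral_piChar {ι : Type*} [Countable ι] {μ ν : Measure (ι → ℝ)}
    [IsFiniteMeasure μ] [IsFiniteMeasure ν]
    (h : ∀ a, ∫ x, piChar a x ∂μ = ∫ x, piChar a x ∂ν) : μ = ν := by
  let := Encodable.ofCountable ι
  let : TopologicalSpace (ι →₀ ℝ) := ⊥
  have : DiscreteTopology (ι →₀ ℝ) := ⟨rfl⟩
  let L : (ι → ℝ) →ₗ[ℝ] (ι →₀ ℝ) →ₗ[ℝ] ℝ := Finsupp.bilinearCombination ℝ ℝ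
  have hL : Continuous fun p : (ι → ℝ) × (ι →₀ ℝ) => L p.1 p.2 := by
    rw [continuous_prod_of_discrete_right]
    intro b
    simp only [L, Finsupp.bilinearCombination_apply, Finsupp.linearCombination_apply, Finsupp.sum]
    fun_prop
  have he : Real.probChar ≠ 1 := by
    intro h1
    have := congrArg (fun e : AddChar ℝ Circle => (e Real.pi : ℂ)) h1
    simp only [Real.probChar_apply, Complex.exp_pi_mul_I] at this
    norm_num at this
  let := TopologicalSpace.upgradeIsCompletelyMetrizable (ι → ℝ)
  refine ext_of_integral_char_eq (V := ι → ℝ) (W := ι →₀ ℝ) Real.continuous_probChar he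
    (L := L) (fun x hx hLx => hx ?_) hL fun a => ?_
  · ext i
    simpa [L, Finsupp.bilinearCombination_apply] using
      congrArg (fun l : (ι →₀ ℝ) →ₗ[ℝ] ℝ => l (Finsupp.single i 1)) hLx
  · simpa [L, Real.probChar_apply, Finsupp.bilinearCombination_apply, piChar] using h a

theorem integrable_mul_piChar {ι : Type*} [Countable ι] {μ : Measure (ι → ℝ)}
    {g : (ι → ℝ) → ℂ} (hg : Integrable g μ) (a : ι →₀ ℝ) :
    Integrable (fun x => g x * piChar a x) μ :=
  hg.mul_bdd (c := 1) (continuous_piChar a).aestronglyMeasurable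
    (ae_of_all _ fun x => (norm_piChar a x).le)

/-- A real integrable function all of whose Fourier coefficients vanish is zero. -/
theorem ae_eq_zero_of_integral_mul_piChar {ι : Type*} [Countable ι] {μ : Measure (ι → ℝ)}
    [IsFiniteMeasure μ] {g : (ι → ℝ) → ℝ} (hg : Integrable g μ)
    (h : ∀ a, ∫ x, (g x : ℂ) * piChar a x ∂μ = 0) : g =ᵐ[μ] 0 := by
  have hfin {f : (ι → ℝ) → ℝ} (hf : Integrable f μ) :
      IsFiniteMeasure (μ.withDensity fun x => ENNReal.ofReal (f x)) :=
    isFiniteMeasure_withDensity_ofReal hf.2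
  have := hfin hg
  have hgn : Integrable (fun x => -g x) μ := hg.neg
  have := hfin hgn
  have hint {f : (ι → ℝ) → ℝ} (hf : Integrable f μ) (a : ι →₀ ℝ) :
      ∫ x, piChar a x ∂(μ.withDensity fun x => ENNReal.ofReal (f x)) =
        ∫ x, ((max (f x) 0 : ℝ) : ℂ) * piChar a x ∂μ := by
    rw [integral_withDensity_eq_integral_toReal_smul₀ hf.aemeasurable.ennreal_ofReal
      (ae_of_all _ fun x => ENNReal.ofReal_lt_top)]
    simp only [ENNReal.toReal_ofReal', Complex.real_smul]
  have hpos {f : (ι → ℝ) → ℝ} (hf : Integrable f μ) :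
      Integrable (fun x => ((max (f x) 0 : ℝ) : ℂ)) μ := hf.pos_part.ofReal
  have heq := ext_of_integral_piChar
    (μ := μ.withDensity fun x => ENNReal.ofReal (g x))
    (ν := μ.withDensity fun x => ENNReal.ofReal (-g x)) fun a => by
      rw [hint hg, hint hgn, ← sub_eq_zero, ← integral_sub
        (integrable_mul_piChar (hpos hg) a) (integrable_mul_piChar (hpos hgn) a), ← h a]
      refine integral_congr_ae (ae_of_all _ fun x => ?_)
      simp only [← sub_mul, ← Complex.ofReal_sub]
      congr 2
      rcases le_total 0 (g x) with h0 | h0 <;> simp [h0]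
  have hae := (withDensity_eq_iff hg.aemeasurable.ennreal_ofReal
    hgn.aemeasurable.ennreal_ofReal hg.lintegral_lt_top.ne).1 heq
  filter_upwards [hae] with x hx
  have hx' := congrArg ENNReal.toReal hx
  simp only [ENNReal.toReal_ofReal'] at hx'
  rw [← max_zero_sub_max_neg_zero_eq_self (g x), hx', sub_self, Pi.zero_apply]

theorem memLp_piChar {ι : Type*} [Countable ι] (μ : Measure (ι → ℝ)) [IsFiniteMeasure μ]
    (a : ι →₀ ℝ) : MemLp (piChar a) 2 μ :=
  MemLp.of_bound (continuous_piChar a).aestronglyMeasurable 1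
    (ae_of_all _ fun x => (norm_piChar a x).le)

/-- Characters span a dense subspace of `L²`. -/
theorem topologicalClosure_span_piChar {ι : Type*} [Countable ι] (μ : Measure (ι → ℝ))
    [IsFiniteMeasure μ] :
    (Submodule.span ℂ (Set.range fun a => (memLp_piChar μ a).toLp)).topologicalClosure = ⊤ := by
  rw [Submodule.topologicalClosure_eq_top_iff, Submodule.eq_bot_iff]
  intro f hf
  have hfi : Integrable f μ := (Lp.memLp f).integrable (by norm_num)
  have h1 (a : ι →₀ ℝ) : ∫ x, f x * piChar a x ∂μ = 0 := by
    have := (Submodule.mem_orthogonal _ _).1 hf _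
      (Submodule.subset_span ⟨-a, rfl⟩)
    rw [L2.inner_def] at this
    rw [← this]
    refine integral_congr_ae ?_
    filter_upwards [(memLp_piChar μ (-a)).coeFn_toLp] with x hx
    rw [hx, RCLike.inner_apply, star_piChar, neg_neg]
  have h2 (a : ι →₀ ℝ) : ∫ x, (starRingEnd ℂ) (f x) * piChar a x ∂μ = 0 := by
    rw [← map_zero (starRingEnd ℂ), ← h1 (-a), ← integral_conj]
    simp [star_piChar]
  have hfc : Integrable (fun x => (starRingEnd ℂ) (f x)) μ :=
    Complex.conjLIE.toContinuousLinearEquiv.toContinuousLinearMap.integrable_comp hfi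
  have hre : (fun x => (f x).re) =ᵐ[μ] 0 := by
    refine ae_eq_zero_of_integral_mul_piChar hfi.re fun a => ?_
    have := integral_add (integrable_mul_piChar hfi a) (integrable_mul_piChar hfc a)
    rw [h1, h2, add_zero] at this
    simp only [← add_mul, Complex.add_conj, Complex.ofReal_mul, mul_assoc,
      integral_const_mul] at this
    simpa using this
  have him : (fun x => (f x).im) =ᵐ[μ] 0 := by
    refine ae_eq_zero_of_integral_mul_piChar hfi.im fun a => ?_
    have := integral_sub (integrable_mul_piChar hfi a) (integrable_mul_piChar hfc a)
    rw [h1, h2, sub_zero] at this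
    simp only [← sub_mul, Complex.sub_conj, Complex.ofReal_mul, mul_assoc, mul_left_comm _ Complex.I,
      integral_const_mul] at this
    simpa using this
  rw [Lp.eq_zero_iff_ae_eq_zero]
  filter_upwards [hre, him] with x h h'
  exact Complex.ext h h'

/-- A nonatomic law of infinite binary sequences whose bits become arbitrarily rare. -/
theorem exists_nonatomic_rare_bits :
    ∃ P : Measure (ℕ → Bool), IsProbabilityMeasure P ∧ NullSingletonClass P ∧
      ∀ j : ℕ, P.real {f | f j = true} = 1 / ((j : ℝ) + 2) := by
  have hp (j : ℕ) : 1 / ((j : ℝ) + 2) ∈ Set.Icc (0 : ℝ) 1 :=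
    ⟨by positivity, by rw [div_le_one (by positivity)]; linarith [(Nat.cast_nonneg j : (0 : ℝ) ≤ j)]⟩
  let B (j : ℕ) : Measure Bool :=
    ProbabilityTheory.bernoulliMeasure true false ⟨1 / ((j : ℝ) + 2), hp j⟩
  have hBt (j : ℕ) : (B j).real {true} = 1 / ((j : ℝ) + 2) := by simp [B]
  have hBf (j : ℕ) : (B j).real {false} = 1 - 1 / ((j : ℝ) + 2) := by simp [B]
  have hB (j : ℕ) (b : Bool) : B j {b} ≤ ENNReal.ofReal (1 - 1 / ((j : ℝ) + 2)) := by
    rw [← ofReal_measureReal]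
    refine ENNReal.ofReal_le_ofReal ?_
    cases b
    · exact (hBf j).le
    · rw [hBt]
      have : 1 / ((j : ℝ) + 2) ≤ 1 / 2 :=
        one_div_le_one_div_of_le two_pos (by linarith [(Nat.cast_nonneg j : (0 : ℝ) ≤ j)])
      linarith
  refine ⟨Measure.infinitePi B, inferInstance, ⟨fun f => ?_⟩, fun j => ?_⟩
  · have hprod (n : ℕ) : ∏ j ∈ Finset.range n, (1 - 1 / ((j : ℝ) + 2)) = 1 / ((n : ℝ) + 1) := by
      induction n with
      | zero => simp
      | succ n ih =>
        rw [Finset.prod_range_succ, ih]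
        push_cast
        field_simp
        ring
    have hle (n : ℕ) : Measure.infinitePi B {f} ≤ ENNReal.ofReal (1 / ((n : ℝ) + 1)) := by
      calc Measure.infinitePi B {f}
          ≤ Measure.infinitePi B (Set.pi (Finset.range n : Set ℕ) fun j => {f j}) :=
            measure_mono (by rintro _ rfl j _; rfl)
        _ = ∏ j ∈ Finset.range n, B j {f j} :=
            Measure.infinitePi_pi _ fun _ _ => measurableSet_singleton _
        _ ≤ ∏ j ∈ Finset.range n, ENNReal.ofReal (1 - 1 / ((j : ℝ) + 2)) :=
            Finset.prod_le_prod' fun j _ => hB j (f j)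
        _ = ENNReal.ofReal (1 / ((n : ℝ) + 1)) := by
            rw [← hprod, ENNReal.ofReal_prod_of_nonneg]
            intro j _
            linarith [(hp j).2]
    have hlim : Tendsto (fun n : ℕ => ENNReal.ofReal (1 / ((n : ℝ) + 1))) atTop (nhds 0) := by
      simpa using ENNReal.tendsto_ofReal (tendsto_one_div_add_atTop_nhds_zero_nat (𝕜 := ℝ))
    exact le_antisymm (ge_of_tendsto' hlim hle) zero_le
  · have := (measurePreserving_eval_infinitePi B j).measureReal_preimage
      (measurableSet_singleton true).nullMeasurableSet
    rw [← hBt j, ← this]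
    rfl

theorem cantorFunction_eq_sum_add {c : ℝ} (f : ℕ → Bool) (h0 : 0 ≤ c) (h1 : c < 1) (m : ℕ) :
    Cardinal.cantorFunction c f = ∑ j ∈ Finset.range m, cond (f j) (c ^ j) 0 +
      c ^ m * Cardinal.cantorFunction c fun j => f (j + m) := by
  have := (Cardinal.summable_cantor_function f h0 h1).sum_add_tsum_nat_add m
  rw [Cardinal.cantorFunction, ← this]
  congr 1
  rw [Cardinal.cantorFunction, ← tsum_mul_left]
  refine tsum_congr fun j => ?_
  cases h : f (j + m) <;> simp [Cardinal.cantorFunctionAux, h, pow_add, mul_comm]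

theorem measurable_cantorFunction {c : ℝ} (h0 : 0 ≤ c) (h1 : c < 1) :
    Measurable (Cardinal.cantorFunction c) := by
  have (j : ℕ) : Measurable fun f : ℕ → Bool => Cardinal.cantorFunctionAux c f j :=
    (measurable_of_countable fun b : Bool => cond b (c ^ j) 0).comp (measurable_pi_apply j)
  exact measurable_of_tendsto_metrizable (fun n => Finset.measurable_fun_sum _ fun j _ => this j)
    (tendsto_pi_nhds.2 fun f =>
      (Cardinal.summable_cantor_function f h0 h1).hasSum.tendsto_sum_nat)

theorem integral_cantorFunction_shift_le {P : Measure (ℕ → Bool)} [IsProbabilityMeasure P]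
    (hP : ∀ j : ℕ, P.real {f | f j = true} = 1 / ((j : ℝ) + 2)) {c : ℝ} (h0 : 0 ≤ c) (h1 : c < 1)
    (m : ℕ) :
    ∫ f, (Cardinal.cantorFunction c fun j => f (j + m)) ∂P ≤ (1 - c)⁻¹ * (1 / ((m : ℝ) + 1)) := by
  have hmeas (j : ℕ) : MeasurableSet {f : ℕ → Bool | f (j + m) = true} :=
    (measurable_pi_apply (j + m) : Measurable fun f : ℕ → Bool => f (j + m))
      (measurableSet_singleton true)
  have heq (j : ℕ) : (fun f : ℕ → Bool => Cardinal.cantorFunctionAux c (fun j => f (j + m)) j) =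
      {f : ℕ → Bool | f (j + m) = true}.indicator fun _ => c ^ j := by
    ext f
    cases h : f (j + m) <;> simp [Cardinal.cantorFunctionAux, h]
  have hint (j : ℕ) : Integrable
      (fun f : ℕ → Bool => Cardinal.cantorFunctionAux c (fun j => f (j + m)) j) P := by
    rw [heq]
    exact (integrable_const _).indicator (hmeas j)
  have hval (j : ℕ) : ∫ f, Cardinal.cantorFunctionAux c (fun j => f (j + m)) j ∂P =
      1 / (((j + m : ℕ) : ℝ) + 2) * c ^ j := by
    rw [heq, integral_indicator_const _ (hmeas j), hP, smul_eq_mul]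
  have hle (j : ℕ) : 1 / (((j + m : ℕ) : ℝ) + 2) * c ^ j ≤ c ^ j * (1 / ((m : ℝ) + 1)) := by
    rw [mul_comm]
    refine mul_le_mul_of_nonneg_left (one_div_le_one_div_of_le (by positivity) ?_) (pow_nonneg h0 j)
    push_cast
    linarith [(Nat.cast_nonneg j : (0 : ℝ) ≤ j)]
  have hgeo := (hasSum_geometric_of_lt_one h0 h1).mul_right (1 / ((m : ℝ) + 1))
  have hsum : Summable fun j : ℕ => 1 / (((j + m : ℕ) : ℝ) + 2) * c ^ j :=
    hgeo.summable.of_nonneg_of_le (fun j => by positivity) hle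
  simp only [Cardinal.cantorFunction]
  rw [← integral_tsum_of_summable_integral_norm hint]
  · simp only [hval]
    exact (hsum.tsum_le_tsum hle hgeo.summable).trans hgeo.tsum_eq.le
  · simpa only [Real.norm_of_nonneg (Cardinal.cantorFunctionAux_nonneg h0), hval] using hsum

/-- A nonatomic random unit complex number `z` with `z ^ k ^ n → 1` in mean. -/
theorem exists_unimodular_rigid (k : ℕ) (hk : 2 ≤ k) :
    ∃ (P : Measure (ℕ → Bool)) (z : (ℕ → Bool) → Circle),
      IsProbabilityMeasure P ∧ NullSingletonClass P ∧
      Measurable (fun f => (z f : ℂ)) ∧ Function.Injective z ∧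
      Tendsto (fun n : ℕ => ∫ f, ‖((z f : ℂ)) ^ k ^ n - 1‖ ∂P) atTop (nhds 0) := by
  obtain ⟨P, hprob, hatom, hP⟩ := exists_nonatomic_rare_bits
  have hk' : (2 : ℝ) ≤ k := by exact_mod_cast hk
  have hk0 : (0 : ℝ) < k := by linarith
  let c : ℝ := ((k : ℝ) ^ 2)⁻¹
  have hc0 : 0 < c := by positivity
  have hc4 : c ≤ 1 / 4 := by
    rw [show (1 : ℝ) / 4 = (4 : ℝ)⁻¹ by norm_num]
    exact inv_anti₀ (by norm_num) (by nlinarith)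
  have hc1 : c < 1 := by linarith
  let θ (f : ℕ → Bool) : ℝ := c * Cardinal.cantorFunction c f
  have hθm : Measurable θ := (measurable_cantorFunction hc0.le hc1).const_mul c
  have hnn (f : ℕ → Bool) : 0 ≤ Cardinal.cantorFunction c f :=
    tsum_nonneg fun n => Cardinal.cantorFunctionAux_nonneg hc0.le
  have hle (f : ℕ → Bool) : Cardinal.cantorFunction c f ≤ 4 / 3 := by
    calc Cardinal.cantorFunction c f ≤ Cardinal.cantorFunction c fun _ => true :=
          Cardinal.cantorFunction_le hc0.le hc1 fun _ _ => rfl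
      _ = (1 - c)⁻¹ := by
          simp only [Cardinal.cantorFunction, Cardinal.cantorFunctionAux, cond_true]
          exact tsum_geometric_of_lt_one hc0.le hc1
      _ ≤ 4 / 3 := by
          rw [inv_le_comm₀ (by linarith) (by norm_num)]
          norm_num
          linarith
  have hθ (f : ℕ → Bool) : 0 ≤ θ f ∧ θ f ≤ 1 / 3 :=
    ⟨mul_nonneg hc0.le (hnn f), by
      change c * Cardinal.cantorFunction c f ≤ 1 / 3
      nlinarith [hnn f, hle f]⟩
  refine ⟨P, fun f => Circle.exp (2 * Real.pi * θ f), hprob, hatom, ?_, ?_, ?_⟩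
  · simp only [Circle.coe_exp]
    fun_prop
  · intro f g hfg
    have hmem (f : ℕ → Bool) : 2 * Real.pi * θ f ∈ Set.Icc 0 Real.pi :=
      ⟨mul_nonneg (by positivity) (hθ f).1, by nlinarith [(hθ f).2, Real.pi_pos]⟩
    have h1 := Circle.exp_injOn_Icc (by linarith [Real.pi_pos]) (hmem f) (hmem g) hfg
    have h2 := mul_left_cancel₀ (by positivity) h1
    exact Cardinal.cantorFunction_injective hc0 (by linarith) (mul_left_cancel₀ hc0.ne' h2)
  · have hbound (n : ℕ) (f : ℕ → Bool) :
        ‖((Circle.exp (2 * Real.pi * θ f) : Circle) : ℂ) ^ k ^ n - 1‖ ≤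
          2 * Real.pi * Cardinal.cantorFunction c fun j => f (j + n / 2) := by
      set m := n / 2 with hm
      set R := Cardinal.cantorFunction c fun j => f (j + m) with hR
      have hpow (j : ℕ) (hj : j ∈ Finset.range m) :
          (k : ℝ) ^ n * (c * c ^ j) = ((k ^ (n - 2 * (j + 1)) : ℕ) : ℝ) := by
        have : n - 2 * (j + 1) + 2 * (j + 1) = n := by
          have := Finset.mem_range.1 hj
          omega
        rw [← pow_succ', inv_pow, ← pow_mul, Nat.cast_pow]
        nth_rewrite 1 [← this]
        rw [pow_add, mul_inv_cancel_right₀ (by positivity)]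
      have hsplit : ((k ^ n : ℕ) : ℝ) * (2 * Real.pi * θ f) =
          2 * Real.pi * ((k : ℝ) ^ n * c ^ (m + 1) * R) +
          ((∑ j ∈ Finset.range m, cond (f j) (k ^ (n - 2 * (j + 1))) 0 : ℕ) : ℤ) *
            (2 * Real.pi) := by
        have h3 : (k : ℝ) ^ n * (c * ∑ j ∈ Finset.range m, cond (f j) (c ^ j) 0) =
            ((∑ j ∈ Finset.range m, cond (f j) (k ^ (n - 2 * (j + 1))) 0 : ℕ) : ℝ) := by
          rw [Finset.mul_sum, Finset.mul_sum, Nat.cast_sum]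
          refine Finset.sum_congr rfl fun j hj => ?_
          cases f j
          · simp
          · simp only [cond_true, hpow j hj]
        rw [Int.cast_natCast, ← h3, Nat.cast_pow]
        simp only [θ]
        rw [cantorFunction_eq_sum_add f hc0.le hc1 m, ← hR]
        ring
      rw [← Circle.coe_pow, ← Circle.exp_nsmul, nsmul_eq_mul, Circle.exp_eq_exp.2 ⟨_, hsplit⟩,
        Circle.coe_exp, mul_comm _ Complex.I]
      refine Real.norm_exp_I_mul_ofReal_sub_one_le.trans ?_
      have hle1 : (k : ℝ) ^ n * c ^ (m + 1) ≤ 1 := by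
        rw [inv_pow, ← pow_mul, ← div_eq_mul_inv, div_le_one (by positivity)]
        exact pow_le_pow_right₀ (by linarith) (by omega)
      have hR0 : 0 ≤ R := hnn _
      rw [Real.norm_of_nonneg (by positivity)]
      exact mul_le_mul_of_nonneg_left (mul_le_of_le_one_left hR0 hle1) (by positivity)
    have hlim : Tendsto (fun n : ℕ => 2 * Real.pi * ((1 - c)⁻¹ * (1 / (((n / 2 : ℕ) : ℝ) + 1))))
        atTop (nhds 0) := by
      have := ((tendsto_one_div_add_atTop_nhds_zero_nat (𝕜 := ℝ)).comp
        (Nat.tendsto_div_const_atTop two_ne_zero)).const_mul (1 - c)⁻¹ |>.const_mul (2 * Real.pi)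
      simpa using this
    refine squeeze_zero (fun n => integral_nonneg fun f => norm_nonneg _) (fun n => ?_) hlim
    have hint : Integrable (fun f : ℕ → Bool =>
        2 * Real.pi * Cardinal.cantorFunction c fun j => f (j + n / 2)) P := by
      refine Integrable.of_bound (C := 2 * Real.pi * (4 / 3))
        (((measurable_cantorFunction hc0.le hc1).comp
        (measurable_pi_lambda _ fun j => measurable_pi_apply (j + n / 2))).const_mul
        _).aestronglyMeasurable (ae_of_all _ fun f => ?_)
      rw [Real.norm_of_nonneg (mul_nonneg (by positivity) (hnn _))]
      exact mul_le_mul_of_nonneg_left (hle _) (by positivity)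
    refine (integral_mono_of_nonneg (ae_of_all _ fun f => norm_nonneg _) hint
      (ae_of_all _ (hbound n))).trans ?_
    rw [integral_const_mul]
    exact mul_le_mul_of_nonneg_left (integral_cantorFunction_shift_le hP hc0.le hc1 _)
      (by positivity)

theorem norm_sum_zpow_le (w : Circle) (hw : w ≠ 1) (c : ℤ) (n : ℕ) :
    ‖∑ i ∈ Finset.range n, ((w ^ ((i : ℤ) + c) : Circle) : ℂ)‖ ≤ 2 / ‖(w : ℂ) - 1‖ := by
  have hw' : (w : ℂ) ≠ 1 := fun h => hw (Subtype.ext h)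
  have (i : ℕ) : ((w ^ ((i : ℤ) + c) : Circle) : ℂ) = ((w ^ c : Circle) : ℂ) * (w : ℂ) ^ i := by
    rw [zpow_add, mul_comm, zpow_natCast, Circle.coe_mul, Circle.coe_pow]
  simp only [this]
  rw [← Finset.mul_sum, norm_mul, Circle.norm_coe, one_mul, geom_sum_eq hw', norm_div]
  gcongr
  calc ‖(w : ℂ) ^ n - 1‖ ≤ ‖(w : ℂ) ^ n‖ + ‖(1 : ℂ)‖ := norm_sub_le _ _
    _ = 2 := by
      rw [norm_pow, Circle.norm_coe]
      norm_num

/-- Wiener's lemma: the Fourier coefficients of a nonatomic law on the circle tend to zero in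
quadratic mean. -/
theorem tendsto_cesaro_sq_norm_integral_zpow {Ω : Type*} [MeasurableSpace Ω] {P : Measure Ω}
    [IsProbabilityMeasure P] [NullSingletonClass P] {z : Ω → Circle}
    (hz : Measurable fun ω => (z ω : ℂ)) (hinj : Function.Injective z) (c : ℤ) :
    Tendsto (fun n : ℕ => (1 / (n : ℝ)) * ∑ i ∈ Finset.range n,
      ‖∫ ω, ((z ω ^ ((i : ℤ) + c) : Circle) : ℂ) ∂P‖ ^ 2) atTop (nhds 0) := by
  let w (p : Ω × Ω) : Circle := z p.1 * (z p.2)⁻¹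
  have hzm (m : ℤ) : Measurable fun ω => ((z ω ^ m : Circle) : ℂ) := by
    simp only [Circle.coe_zpow]
    exact hz.pow_const m
  have hwm (m : ℤ) : Measurable fun p => ((w p ^ m : Circle) : ℂ) := by
    simp only [w, mul_zpow, inv_zpow', Circle.coe_mul]
    exact ((hzm m).comp measurable_fst).mul ((hzm (-m)).comp measurable_snd)
  have hwi (m : ℤ) : Integrable (fun p => ((w p ^ m : Circle) : ℂ)) (P.prod P) :=
    .of_bound (hwm m).aestronglyMeasurable 1 (ae_of_all _ fun p => (Circle.norm_coe _).le)
  have hsq (m : ℤ) : ((‖∫ ω, ((z ω ^ m : Circle) : ℂ) ∂P‖ ^ 2 : ℝ) : ℂ) =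
      ∫ p, ((w p ^ m : Circle) : ℂ) ∂(P.prod P) := by
    simp only [w, mul_zpow, Circle.coe_mul]
    rw [integral_prod_mul (fun ω => ((z ω ^ m : Circle) : ℂ))
      (fun ω => (((z ω)⁻¹ ^ m : Circle) : ℂ)), Complex.ofReal_pow, ← Complex.mul_conj',
      ← integral_conj]
    simp only [inv_zpow, Circle.coe_inv_eq_conj]
  have hne : ∀ᵐ p ∂(P.prod P), w p ≠ 1 := by
    have hset : MeasurableSet {p : Ω × Ω | w p = 1} := by
      have : {p : Ω × Ω | w p = 1} = {p | (z p.1 : ℂ) = z p.2} := by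
        ext p
        simp only [w, Set.mem_ofPred_eq, mul_inv_eq_one, Circle.ext_iff]
      rw [this]
      exact measurableSet_eq_fun (hz.comp measurable_fst) (hz.comp measurable_snd)
    rw [ae_iff]
    simp only [not_not]
    rw [Measure.measure_prod_null hset]
    refine ae_of_all _ fun ω => ?_
    have : Prod.mk ω ⁻¹' {p : Ω × Ω | w p = 1} = {ω} := by
      ext ω'
      simp only [w, Set.mem_preimage, Set.mem_ofPred_eq, mul_inv_eq_one, hinj.eq_iff,
        Set.mem_singleton_iff, eq_comm]
    simp [this]
  have hlim : Tendsto (fun n : ℕ => ∫ p, (1 / (n : ℂ)) *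
      ∑ i ∈ Finset.range n, ((w p ^ ((i : ℤ) + c) : Circle) : ℂ) ∂(P.prod P)) atTop (nhds 0) := by
    rw [← integral_zero (Ω × Ω) ℂ (μ := P.prod P)]
    refine tendsto_integral_of_dominated_convergence (fun _ => 1) (fun n => ?_)
      (integrable_const _) (fun n => ae_of_all _ fun p => ?_) ?_
    · exact ((Finset.measurable_fun_sum _ fun i _ => hwm _).const_mul _).aestronglyMeasurable
    · rw [norm_mul, norm_div, norm_one, Complex.norm_natCast]
      refine (mul_le_mul_of_nonneg_left (norm_sum_le _ _) (by positivity)).trans ?_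
      simp only [Circle.norm_coe, Finset.sum_const, Finset.card_range, nsmul_eq_mul, mul_one]
      rw [one_div_mul_eq_div]
      exact div_self_le_one _
    · filter_upwards [hne] with p hp
      have hd : Tendsto (fun n : ℕ => 1 / (n : ℝ) * (2 / ‖(w p : ℂ) - 1‖)) atTop (nhds 0) := by
        simpa using tendsto_one_div_atTop_nhds_zero_nat.mul_const (2 / ‖(w p : ℂ) - 1‖)
      refine squeeze_zero_norm (fun n => ?_) hd
      rw [norm_mul, norm_div, norm_one, Complex.norm_natCast]
      exact mul_le_mul_of_nonneg_left (norm_sum_zpow_le _ hp c n)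
        (one_div_nonneg.2 n.cast_nonneg)
  have hre := (Complex.continuous_re.tendsto 0).comp hlim
  rw [Complex.zero_re] at hre
  refine hre.congr fun n => ?_
  rw [Function.comp_apply, integral_const_mul, integral_finsetSum _ fun i _ => hwi _]
  simp only [← hsq]
  rw [← Complex.ofReal_sum, ← Complex.ofReal_natCast, ← Complex.ofReal_one, ← Complex.ofReal_div,
    ← Complex.ofReal_mul, Complex.ofReal_re]

/-- A sequence tending to zero in quadratic mean tends to zero in mean. -/
theorem tendsto_cesaro_of_sq {u : ℕ → ℝ}
    (h : Tendsto (fun n : ℕ => (1 / (n : ℝ)) * ∑ i ∈ Finset.range n, u i ^ 2) atTop (nhds 0)) :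
    Tendsto (fun n : ℕ => (1 / (n : ℝ)) * ∑ i ∈ Finset.range n, |u i|) atTop (nhds 0) := by
  have h' := (Real.continuous_sqrt.tendsto 0).comp h
  rw [Real.sqrt_zero] at h'
  refine squeeze_zero (fun n => by positivity) (fun n => Real.le_sqrt_of_sq_le ?_) h'
  have := sq_sum_le_card_mul_sum_sq (s := Finset.range n) (f := fun i => |u i|)
  simp only [Finset.card_range, sq_abs] at this
  rcases n.eq_zero_or_pos with rfl | hn
  · simp
  have hn' : (0 : ℝ) < n := by exact_mod_cast hn
  calc ((1 / (n : ℝ)) * ∑ i ∈ Finset.range n, |u i|) ^ 2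
      ≤ (1 / (n : ℝ)) ^ 2 * (n * ∑ i ∈ Finset.range n, u i ^ 2) := by
        rw [mul_pow]
        gcongr
    _ = (1 / (n : ℝ)) * ∑ i ∈ Finset.range n, u i ^ 2 := by
        field_simp

/-- A stationary sequence of vectors whose correlations tend to zero in mean and which is rigid
along `k ^ n`. -/
theorem exists_stationary_rigid (k : ℕ) (hk : 2 ≤ k) :
    ∃ (H : Type) (_ : NormedAddCommGroup H) (_ : InnerProductSpace ℝ H) (v : ℤ → H) (r : ℤ → ℝ),
      (∀ n m, inner ℝ (v n) (v m) = r (m - n)) ∧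
      (∀ c : ℤ, Tendsto (fun n : ℕ => (1 / (n : ℝ)) * ∑ i ∈ Finset.range n, |r ((i : ℤ) + c)|)
        atTop (nhds 0)) ∧
      Tendsto (fun n : ℕ => r ((k ^ n : ℕ) : ℤ)) atTop (nhds (r 0)) := by
  obtain ⟨P, z, hprob, hatom, hz, hinj, hrig⟩ := exists_unimodular_rigid k hk
  have hzm (m : ℤ) : Measurable fun ω => ((z ω ^ m : Circle) : ℂ) := by
    simp only [Circle.coe_zpow]
    exact hz.pow_const m
  have hL (m : ℤ) : MemLp (fun ω => ((z ω ^ m : Circle) : ℂ)) 2 P :=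
    MemLp.of_bound (hzm m).aestronglyMeasurable 1 (ae_of_all _ fun p => (Circle.norm_coe _).le)
  have hint (m : ℤ) : Integrable (fun ω => ((z ω ^ m : Circle) : ℂ)) P :=
    (hL m).integrable (by norm_num)
  let r (m : ℤ) : ℝ := (∫ ω, ((z ω ^ m : Circle) : ℂ) ∂P).re
  refine ⟨Lp ℂ 2 P, inferInstance, inferInstance, fun m => (hL m).toLp, r, ?_, ?_, ?_⟩
  · intro n m
    rw [L2.inner_def]
    simp only [r]
    rw [← RCLike.re_eq_complex_re, ← integral_re (hint _)]
    refine integral_congr_ae ?_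
    filter_upwards [(hL n).coeFn_toLp, (hL m).coeFn_toLp] with ω h1 h2
    rw [h1, h2, Complex.inner, ← Circle.coe_inv_eq_conj, ← Circle.coe_mul, ← zpow_neg, ← zpow_add,
      ← sub_eq_add_neg, RCLike.re_eq_complex_re]
  · intro c
    refine tendsto_cesaro_of_sq (squeeze_zero (fun n => by positivity) (fun n => ?_)
      (tendsto_cesaro_sq_norm_integral_zpow (P := P) hz hinj c))
    gcongr _ * ∑ i ∈ _, ?_ with i
    rw [← sq_abs]
    gcongr
    exact Complex.abs_re_le_norm _
  · have h0 : r 0 = 1 := by simp [r]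
    rw [h0, tendsto_iff_norm_sub_tendsto_zero]
    refine squeeze_zero (fun _ => norm_nonneg _) (fun n => ?_) hrig
    have : r ((k ^ n : ℕ) : ℤ) - 1 = (∫ ω, ((z ω : ℂ) ^ k ^ n - 1) ∂P).re := by
      have hi := hint ((k ^ n : ℕ) : ℤ)
      simp only [zpow_natCast, Circle.coe_pow] at hi
      rw [integral_sub hi (integrable_const _)]
      simp only [r, zpow_natCast, Circle.coe_pow]
      simp
    rw [this]
    exact (Complex.abs_re_le_norm _).trans (norm_integral_le_integral_norm _)

/-- A uniformly bounded sequence of seminorms that tends to zero pointwise on a set with dense span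
tends to zero pointwise. -/
theorem tendsto_zero_of_dense_span {E : Type*} [NormedAddCommGroup E] [NormedSpace ℂ E]
    {s : Set E} (hs : (Submodule.span ℂ s).topologicalClosure = ⊤) {ψ : ℕ → E → ℝ} {C : ℝ}
    (hnonneg : ∀ n x, 0 ≤ ψ n x) (hadd : ∀ n x y, ψ n (x + y) ≤ ψ n x + ψ n y)
    (hsmul : ∀ n (a : ℂ) x, ψ n (a • x) ≤ ‖a‖ * ψ n x) (hbound : ∀ n x, ψ n x ≤ C * ‖x‖)
    (h : ∀ x ∈ s, Tendsto (fun n => ψ n x) atTop (nhds 0)) (x : E) :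
    Tendsto (fun n => ψ n x) atTop (nhds 0) := by
  let M : Submodule ℂ E :=
    { carrier := {x | Tendsto (fun n => ψ n x) atTop (nhds 0)}
      zero_mem' := squeeze_zero (hnonneg · 0) (fun n => by simpa using hbound n 0)
        tendsto_const_nhds
      add_mem' := fun {x y} hx hy => squeeze_zero (hnonneg · _) (hadd · x y)
        (by simpa using Tendsto.add hx hy)
      smul_mem' := fun a x hx => squeeze_zero (hnonneg · _) (hsmul · a x)
        (by simpa using Tendsto.const_mul ‖a‖ hx) }
  have hM : Submodule.span ℂ s ≤ M := Submodule.span_le.2 h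
  have hx : x ∈ closure (Submodule.span ℂ s : Set E) := by
    rw [← Submodule.topologicalClosure_coe, hs]
    trivial
  rw [Metric.tendsto_atTop]
  intro ε hε
  have hD : 0 < |C| + 1 := by positivity
  obtain ⟨y, hy, hxy⟩ := Metric.mem_closure_iff.1 hx (ε / 2 / (|C| + 1)) (by positivity)
  obtain ⟨N, hN⟩ := Metric.tendsto_atTop.1 (hM hy) (ε / 2) (by positivity)
  refine ⟨N, fun n hn => ?_⟩
  have h1 := hN n hn
  rw [Real.dist_0_eq_abs, abs_of_nonneg (hnonneg _ _)] at h1 ⊢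
  rw [dist_eq_norm, lt_div_iff₀ hD] at hxy
  calc ψ n x = ψ n (x - y + y) := by rw [sub_add_cancel]
    _ ≤ C * ‖x - y‖ + ψ n y := (hadd _ _ _).trans (add_le_add_left (hbound _ _) _)
    _ ≤ ‖x - y‖ * (|C| + 1) + ψ n y := by
        rw [mul_comm]
        gcongr
        linarith [le_abs_self C]
    _ < ε := by linarith

theorem tendsto_cesaro_norm_of_dense_span {E : Type*} [NormedAddCommGroup E] [NormedSpace ℂ E]
    {s : Set E} (hs : (Submodule.span ℂ s).topologicalClosure = ⊤) {l : ℕ → E →ₗ[ℂ] ℂ} {C : ℝ}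
    (hbound : ∀ i x, ‖l i x‖ ≤ C * ‖x‖)
    (h : ∀ x ∈ s, Tendsto (fun n : ℕ => (1 / (n : ℝ)) * ∑ i ∈ Finset.range n, ‖l i x‖)
      atTop (nhds 0)) (x : E) :
    Tendsto (fun n : ℕ => (1 / (n : ℝ)) * ∑ i ∈ Finset.range n, ‖l i x‖) atTop (nhds 0) := by
  have hn (n : ℕ) : 0 ≤ 1 / (n : ℝ) := by positivity
  refine tendsto_zero_of_dense_span hs (C := |C|)
    (ψ := fun n x => (1 / (n : ℝ)) * ∑ i ∈ Finset.range n, ‖l i x‖)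
    (fun n x => by positivity) (fun n x y => ?_) (fun n a x => ?_) (fun n x => ?_) h x
  · rw [← mul_add, ← Finset.sum_add_distrib]
    refine mul_le_mul_of_nonneg_left (Finset.sum_le_sum fun i _ => ?_) (hn n)
    rw [map_add]
    exact norm_add_le _ _
  · simp only [map_smul, norm_smul, ← Finset.mul_sum]
    exact (mul_left_comm _ _ _).le
  · calc (1 / (n : ℝ)) * ∑ i ∈ Finset.range n, ‖l i x‖
        ≤ (1 / (n : ℝ)) * ∑ i ∈ Finset.range n, |C| * ‖x‖ := by
          refine mul_le_mul_of_nonneg_left (Finset.sum_le_sum fun i _ => ?_) (hn n)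
          exact (hbound i x).trans (mul_le_mul_of_nonneg_right (le_abs_self C) (norm_nonneg x))
      _ = ((n : ℝ) / n) * (|C| * ‖x‖) := by
          rw [Finset.sum_const, Finset.card_range, nsmul_eq_mul]
          ring
      _ ≤ |C| * ‖x‖ := mul_le_of_le_one_left (by positivity) (div_self_le_one _)

/-- Decay in mean of correlations needs to be checked only on a set with dense span. -/
theorem tendsto_cesaro_inner_of_dense_span {E : Type*} [NormedAddCommGroup E]
    [InnerProductSpace ℂ E] {s : Set E} (hs : (Submodule.span ℂ s).topologicalClosure = ⊤)
    (U : ℕ → E →ₗᵢ[ℂ] E) {e : E} (he : ‖e‖ ≤ 1)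
    (h : ∀ x ∈ s, ∀ y ∈ s, Tendsto (fun n : ℕ => (1 / (n : ℝ)) *
      ∑ i ∈ Finset.range n, ‖inner ℂ y (U i x) - inner ℂ y e * inner ℂ e x‖) atTop (nhds 0))
    (x y : E) : Tendsto (fun n : ℕ => (1 / (n : ℝ)) *
      ∑ i ∈ Finset.range n, ‖inner ℂ y (U i x) - inner ℂ y e * inner ℂ e x‖) atTop (nhds 0) := by
  have hb (i : ℕ) (x y : E) :
      ‖inner ℂ y (U i x) - inner ℂ y e * inner ℂ e x‖ ≤ 2 * ‖y‖ * ‖x‖ := by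
    have h1 : ‖inner ℂ y (U i x)‖ ≤ ‖y‖ * ‖x‖ := by
      simpa only [(U i).norm_map] using norm_inner_le_norm (𝕜 := ℂ) y (U i x)
    have h2 : ‖inner ℂ y e‖ ≤ ‖y‖ :=
      (norm_inner_le_norm y e).trans (mul_le_of_le_one_right (norm_nonneg y) he)
    have h3 : ‖inner ℂ e x‖ ≤ ‖x‖ :=
      (norm_inner_le_norm e x).trans (mul_le_of_le_one_left (norm_nonneg x) he)
    have h4 := mul_le_mul h2 h3 (norm_nonneg _) (norm_nonneg y)
    rw [← norm_mul] at h4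
    linarith [norm_sub_le (inner ℂ y (U i x)) (inner ℂ y e * inner ℂ e x)]
  have hleft (y : E) (hy : y ∈ s) (x : E) : Tendsto (fun n : ℕ => (1 / (n : ℝ)) *
      ∑ i ∈ Finset.range n, ‖inner ℂ y (U i x) - inner ℂ y e * inner ℂ e x‖) atTop (nhds 0) :=
    tendsto_cesaro_norm_of_dense_span hs (C := 2 * ‖y‖)
      (l := fun i => (innerₛₗ ℂ y).comp (U i).toLinearMap - inner ℂ y e • innerₛₗ ℂ e)
      (fun i x => hb i x y) (fun x hx => h x hx y hy) x
  have hconj (i : ℕ) (y : E) : ‖inner ℂ y (U i x) - inner ℂ y e * inner ℂ e x‖ =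
      ‖inner ℂ (U i x) y - inner ℂ x e * inner ℂ e y‖ := by
    rw [← RCLike.norm_conj, map_sub, map_mul]
    simp only [inner_conj_symm]
    rw [mul_comm]
  have := tendsto_cesaro_norm_of_dense_span hs (C := 2 * ‖x‖)
    (l := fun i => innerₛₗ ℂ (U i x) - inner ℂ x e • innerₛₗ ℂ e)
    (fun i y => ((hconj i y).symm.trans_le (hb i x y)).trans_eq (by ring))
    (fun y hy => (hleft y hy x).congr fun n => by simp only [hconj]; rfl) y
  exact this.congr fun n => by simp only [hconj]; rfl

theorem measurableEmbedding_iterate {X : Type*} [MeasurableSpace X] (T : X ≃ᵐ X) (n : ℕ) :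
    MeasurableEmbedding (⇑T)^[n] := by
  induction n with
  | zero => exact MeasurableEmbedding.id
  | succ n ih => exact ih.comp T.measurableEmbedding

section Koopman

variable {X : Type*} [MeasurableSpace X] {μ : Measure X} [IsProbabilityMeasure μ]

theorem compMeasurePreservingₗᵢ_indicatorConstLp {T : X → X} (hT : MeasurePreserving T μ μ)
    {A : Set X} (hA : MeasurableSet A) :
    Lp.compMeasurePreservingₗᵢ ℂ T hT (indicatorConstLp 2 hA (measure_ne_top μ _) (1 : ℂ)) =
      indicatorConstLp 2 (hT.measurable hA) (measure_ne_top μ _) (1 : ℂ) :=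
  Lp.indicatorConstLp_compMeasurePreserving hA (measure_ne_top μ _) 1 hT

/-- The spectral criterion for weak mixing, on a set of functions with dense span. -/
theorem weakMixing_of_dense_span (T : X ≃ᵐ X) (hT : MeasurePreserving T μ μ)
    {s : Set (Lp ℂ 2 μ)} (hs : (Submodule.span ℂ s).topologicalClosure = ⊤)
    (h : ∀ f ∈ s, ∀ g ∈ s, Tendsto (fun n : ℕ => (1 / (n : ℝ)) * ∑ i ∈ Finset.range n,
      ‖inner ℂ g (Lp.compMeasurePreserving T^[i] (hT.iterate i) f) -
        inner ℂ g (indicatorConstLp 2 MeasurableSet.univ (measure_ne_top μ _) (1 : ℂ)) *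
        inner ℂ (indicatorConstLp 2 MeasurableSet.univ (measure_ne_top μ _) (1 : ℂ)) f‖)
      atTop (nhds 0)) :
    WeakMixing μ T := by
  intro A B hA hB
  have he : ‖indicatorConstLp 2 MeasurableSet.univ (measure_ne_top μ _) (1 : ℂ)‖ ≤ 1 := by
    rw [norm_indicatorConstLp two_ne_zero ENNReal.ofNat_ne_top]
    simp
  refine (tendsto_cesaro_inner_of_dense_span hs
    (fun i => Lp.compMeasurePreservingₗᵢ ℂ T^[i] (hT.iterate i)) he h
    (indicatorConstLp 2 hB (measure_ne_top μ _) (1 : ℂ))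
    (indicatorConstLp 2 hA (measure_ne_top μ _) (1 : ℂ))).congr fun n => ?_
  congr 1
  refine Finset.sum_congr rfl fun i _ => ?_
  have hemb := measurableEmbedding_iterate T i
  have hm : μ (T^[i] '' A ∩ B) = μ (A ∩ T^[i] ⁻¹' B) := by
    rw [← (hT.iterate i).measure_preimage_emb hemb, Set.preimage_inter,
      Set.preimage_image_eq _ hemb.injective]
  rw [hm, compMeasurePreservingₗᵢ_indicatorConstLp _ hB]
  simp only [L2.inner_indicatorConstLp_one_indicatorConstLp_one, Set.univ_inter, Set.inter_univ]
  rw [← Real.norm_eq_abs, ← Complex.norm_real]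
  simp [Measure.real]

/-- Rigidity needs to be checked only on a set of functions with dense span. -/
theorem rigiditySeq_of_dense_span (T : X ≃ᵐ X) (hT : MeasurePreserving T μ μ) {ρ : ℕ → ℕ}
    {s : Set (Lp ℂ 2 μ)} (hs : (Submodule.span ℂ s).topologicalClosure = ⊤)
    (h : ∀ f ∈ s, Tendsto (fun n : ℕ =>
      ‖Lp.compMeasurePreserving T^[ρ n] (hT.iterate (ρ n)) f - f‖) atTop (nhds 0)) :
    RigiditySeq μ T ρ := by
  intro A hA
  have hlim := tendsto_zero_of_dense_span hs (C := 2)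
    (ψ := fun n f => ‖Lp.compMeasurePreservingₗᵢ ℂ T^[ρ n] (hT.iterate (ρ n)) f - f‖)
    (fun _ _ => norm_nonneg _)
    (fun n f g => by
      rw [map_add, add_sub_add_comm]
      exact norm_add_le _ _)
    (fun n a f => by rw [map_smul, ← smul_sub, norm_smul])
    (fun n f => (norm_sub_le _ _).trans_eq (by rw [LinearIsometry.norm_map]; ring)) h
    (indicatorConstLp 2 hA (measure_ne_top μ _) (1 : ℂ))
  have hm (n : ℕ) : (μ (symmDiff (T^[ρ n] '' A) A)).toReal =
      ‖Lp.compMeasurePreservingₗᵢ ℂ T^[ρ n] (hT.iterate (ρ n))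
        (indicatorConstLp 2 hA (measure_ne_top μ _) (1 : ℂ)) -
        indicatorConstLp 2 hA (measure_ne_top μ _) (1 : ℂ)‖ ^ 2 := by
    have hemb := measurableEmbedding_iterate T (ρ n)
    have hpre : μ (symmDiff (T^[ρ n] '' A) A) = μ (symmDiff (T^[ρ n] ⁻¹' A) A) := by
      rw [← (hT.iterate (ρ n)).measure_preimage_emb hemb, Set.preimage_symmDiff,
        Set.preimage_image_eq _ hemb.injective, symmDiff_comm]
    rw [← dist_eq_norm, compMeasurePreservingₗᵢ_indicatorConstLp _ hA,
      dist_indicatorConstLp_eq_norm, norm_indicatorConstLp two_ne_zero ENNReal.ofNat_ne_top, hpre,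
      norm_one, one_mul, ENNReal.toReal_ofNat, ← Real.sqrt_eq_rpow,
      Real.sq_sqrt measureReal_nonneg, measureReal_def]
  rw [← ENNReal.tendsto_toReal_iff (fun n => measure_ne_top μ _) ENNReal.zero_ne_top]
  simp only [hm]
  simpa using hlim.pow 2

end Koopman

/-- The shift on real sequences indexed by `ℤ`. -/
def coordinateShift : (ℤ → ℝ) ≃ᵐ (ℤ → ℝ) where
  toFun x n := x (n + 1)
  invFun x n := x (n - 1)
  left_inv x := by simp
  right_inv x := by simp
  measurable_toFun := measurable_pi_lambda _ fun n => measurable_pi_apply (n + 1)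
  measurable_invFun := measurable_pi_lambda _ fun n => measurable_pi_apply (n - 1)

theorem coordinateShift_iterate_apply (i : ℕ) (x : ℤ → ℝ) (n : ℤ) :
    (⇑coordinateShift)^[i] x n = x (n + i) := by
  induction i generalizing x with
  | zero => simp
  | succ i ih =>
    rw [Function.iterate_succ_apply, ih]
    change x (n + i + 1) = _
    push_cast
    rw [add_assoc]

theorem piChar_coordinateShift_iterate (a : ℤ →₀ ℝ) (i : ℕ) (x : ℤ → ℝ) :
    piChar a ((⇑coordinateShift)^[i] x) = piChar (a.mapDomain (· + (i : ℤ))) x := by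
  rw [piChar, piChar, Finsupp.linearCombination_mapDomain]
  congr 5
  funext n
  exact coordinateShift_iterate_apply i x n

theorem inner_linearCombination {ι H : Type*} [NormedAddCommGroup H] [InnerProductSpace ℝ H]
    (v w : ι → H) (a b : ι →₀ ℝ) :
    inner ℝ (Finsupp.linearCombination ℝ v a) (Finsupp.linearCombination ℝ w b) =
      ∑ n ∈ a.support, ∑ m ∈ b.support, a n * b m * inner ℝ (v n) (w m) := by
  simp only [Finsupp.linearCombination_apply, Finsupp.sum, sum_inner]
  simp only [inner_sum, real_inner_smul_left, real_inner_smul_right]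
  exact Finset.sum_congr rfl fun n _ => Finset.sum_congr rfl fun m _ => by ring

theorem abs_exp_sub_exp_le_of_nonpos {x y : ℝ} (hx : x ≤ 0) (hy : y ≤ 0) :
    |Real.exp x - Real.exp y| ≤ |x - y| := by
  wlog h : y ≤ x generalizing x y
  · rw [abs_sub_comm, abs_sub_comm x]
    exact this hy hx (le_of_not_ge h)
  rw [abs_of_nonneg (sub_nonneg.2 (Real.exp_le_exp.2 h)), abs_of_nonneg (sub_nonneg.2 h)]
  have h1 : Real.exp y = Real.exp x * Real.exp (y - x) := by
    rw [← Real.exp_add, add_sub_cancel]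
  have h2 := Real.add_one_le_exp (y - x)
  have h3 := Real.exp_le_one_iff.2 hx
  have h4 := Real.exp_le_one_iff.2 (sub_nonpos.2 h)
  rw [h1]
  nlinarith [Real.exp_pos x]

section GaussianShift

variable {H : Type*} [NormedAddCommGroup H] [InnerProductSpace ℝ H] {v : ℤ → H} {r : ℤ → ℝ}
  {ν : Measure (ℤ → ℝ)} [IsProbabilityMeasure ν]

theorem norm_linearCombination_mapDomain_add (hv : ∀ n m, inner ℝ (v n) (v m) = r (m - n))
    (a : ℤ →₀ ℝ) (i : ℤ) :
    ‖Finsupp.linearCombination ℝ v (a.mapDomain (· + i))‖ =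
      ‖Finsupp.linearCombination ℝ v a‖ := by
  rw [← sq_eq_sq₀ (norm_nonneg _) (norm_nonneg _), ← real_inner_self_eq_norm_sq,
    ← real_inner_self_eq_norm_sq, Finsupp.linearCombination_mapDomain, inner_linearCombination,
    inner_linearCombination]
  simp only [Function.comp_apply, hv, add_sub_add_right_eq_sub]

theorem measurePreserving_coordinateShift (hv : ∀ n m, inner ℝ (v n) (v m) = r (m - n))
    (hν : ∀ a, ∫ x, piChar a x ∂ν =
      (Real.exp (-‖Finsupp.linearCombination ℝ v a‖ ^ 2 / 2) : ℂ)) :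
    MeasurePreserving (⇑coordinateShift) ν ν := by
  refine ⟨coordinateShift.measurable, ?_⟩
  have := Measure.isProbabilityMeasure_map (μ := ν) coordinateShift.measurable.aemeasurable
  refine ext_of_integral_piChar fun a => ?_
  rw [coordinateShift.measurableEmbedding.integral_map, hν,
    ← norm_linearCombination_mapDomain_add hv a ((1 : ℕ) : ℤ), ← hν]
  exact integral_congr_ae (ae_of_all _ fun x => piChar_coordinateShift_iterate a 1 x)

theorem inner_toLp_piChar (hν : ∀ a, ∫ x, piChar a x ∂ν =
      (Real.exp (-‖Finsupp.linearCombination ℝ v a‖ ^ 2 / 2) : ℂ)) (a b : ℤ →₀ ℝ) :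
    inner ℂ (memLp_piChar ν b).toLp (memLp_piChar ν a).toLp =
      (Real.exp (-‖Finsupp.linearCombination ℝ v (a - b)‖ ^ 2 / 2) : ℂ) := by
  rw [← hν, L2.inner_def]
  refine integral_congr_ae ?_
  filter_upwards [(memLp_piChar ν a).coeFn_toLp, (memLp_piChar ν b).coeFn_toLp] with x ha hb
  rw [ha, hb, RCLike.inner_apply, star_piChar, piChar_mul, sub_eq_add_neg]

theorem compMeasurePreserving_toLp_piChar (i : ℕ)
    (hT : MeasurePreserving (⇑coordinateShift)^[i] ν ν) (a : ℤ →₀ ℝ) :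
    Lp.compMeasurePreserving (⇑coordinateShift)^[i] hT (memLp_piChar ν a).toLp =
      (memLp_piChar ν (a.mapDomain (· + (i : ℤ)))).toLp := by
  rw [Lp.toLp_compMeasurePreserving]
  congr 1
  ext x
  exact piChar_coordinateShift_iterate a i x

theorem toLp_piChar_zero : indicatorConstLp 2 MeasurableSet.univ (measure_ne_top ν _) (1 : ℂ) =
    (memLp_piChar ν 0).toLp := by
  rw [indicatorConstLp]
  congr 1
  ext x
  simp [piChar]

/-- A stationary Gaussian system whose correlations tend to zero in mean is weak mixing. -/
theorem weakMixing_coordinateShift (hv : ∀ n m, inner ℝ (v n) (v m) = r (m - n))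
    (hν : ∀ a, ∫ x, piChar a x ∂ν =
      (Real.exp (-‖Finsupp.linearCombination ℝ v a‖ ^ 2 / 2) : ℂ))
    (hr : ∀ c : ℤ, Tendsto (fun n : ℕ => (1 / (n : ℝ)) *
      ∑ i ∈ Finset.range n, |r ((i : ℤ) + c)|) atTop (nhds 0)) :
    WeakMixing ν (⇑coordinateShift) := by
  refine weakMixing_of_dense_span coordinateShift (measurePreserving_coordinateShift hv hν)
    (topologicalClosure_span_piChar ν) ?_
  rintro _ ⟨a, rfl⟩ _ ⟨b, rfl⟩
  have hterm (i : ℕ) :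
      ‖inner ℂ (memLp_piChar ν b).toLp (memLp_piChar ν (a.mapDomain (· + (i : ℤ)))).toLp -
        inner ℂ (memLp_piChar ν b).toLp (memLp_piChar ν 0).toLp *
        inner ℂ (memLp_piChar ν 0).toLp (memLp_piChar ν a).toLp‖ ≤
      ∑ n ∈ a.support, ∑ m ∈ b.support, |a n| * |b m| * |r ((i : ℤ) + (n - m))| := by
    simp only [inner_toLp_piChar hν]
    rw [← Complex.ofReal_mul, ← Real.exp_add, ← Complex.ofReal_sub, Complex.norm_real,
      Real.norm_eq_abs]
    refine (abs_exp_sub_exp_le_of_nonpos ?_ ?_).trans ?_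
    · nlinarith [sq_nonneg ‖Finsupp.linearCombination ℝ v (a.mapDomain (· + (i : ℤ)) - b)‖]
    · nlinarith [sq_nonneg ‖Finsupp.linearCombination ℝ v (0 - b)‖,
        sq_nonneg ‖Finsupp.linearCombination ℝ v (a - 0)‖]
    · rw [map_sub, norm_sub_sq_real, norm_linearCombination_mapDomain_add hv, zero_sub, map_neg,
        norm_neg, sub_zero, real_inner_comm, Finsupp.linearCombination_mapDomain,
        inner_linearCombination, Finset.sum_comm]
      simp only [hv, Function.comp_apply]
      have key (A B S : ℝ) : -(A - 2 * S + B) / 2 - (-B / 2 + -A / 2) = S := by ring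
      rw [key]
      refine (Finset.abs_sum_le_sum_abs _ _).trans (Finset.sum_le_sum fun n _ =>
        (Finset.abs_sum_le_sum_abs _ _).trans_eq (Finset.sum_congr rfl fun m _ => ?_))
      rw [abs_mul, abs_mul, mul_comm |b m|, add_comm n, add_sub_assoc]
  have hlim : Tendsto (fun N : ℕ => ∑ n ∈ a.support, ∑ m ∈ b.support, |a n| * |b m| *
      ((1 / (N : ℝ)) * ∑ i ∈ Finset.range N, |r ((i : ℤ) + (n - m))|)) atTop (nhds 0) := by
    rw [← Finset.sum_const_zero (s := a.support)]
    refine tendsto_finsetSum _ fun n _ => ?_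
    rw [← Finset.sum_const_zero (s := b.support)]
    refine tendsto_finsetSum _ fun m _ => ?_
    simpa using (hr (n - m)).const_mul (|a n| * |b m|)
  refine squeeze_zero (fun N => by positivity) (fun N => ?_) hlim
  rw [toLp_piChar_zero]
  simp only [compMeasurePreserving_toLp_piChar]
  refine (mul_le_mul_of_nonneg_left (Finset.sum_le_sum fun i _ => hterm i)
    (by positivity)).trans_eq ?_
  rw [Finset.sum_comm, Finset.mul_sum]
  refine Finset.sum_congr rfl fun n _ => ?_
  rw [Finset.sum_comm, Finset.mul_sum]
  refine Finset.sum_congr rfl fun m _ => ?_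
  rw [← Finset.mul_sum]
  exact mul_left_comm _ _ _

/-- A stationary Gaussian system is rigid along `ρ` if its correlations are. -/
theorem rigiditySeq_coordinateShift (hv : ∀ n m, inner ℝ (v n) (v m) = r (m - n))
    (hν : ∀ a, ∫ x, piChar a x ∂ν =
      (Real.exp (-‖Finsupp.linearCombination ℝ v a‖ ^ 2 / 2) : ℂ)) {ρ : ℕ → ℕ}
    (hρ : Tendsto (fun n => r (ρ n : ℤ)) atTop (nhds (r 0))) :
    RigiditySeq ν (⇑coordinateShift) ρ := by
  refine rigiditySeq_of_dense_span coordinateShift (measurePreserving_coordinateShift hv hν)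
    (topologicalClosure_span_piChar ν) ?_
  rintro _ ⟨a, rfl⟩
  simp only [compMeasurePreserving_toLp_piChar]
  have hle (i : ℕ) : ‖(memLp_piChar ν (a.mapDomain (· + (i : ℤ)))).toLp -
      (memLp_piChar ν a).toLp‖ ≤ ‖Finsupp.linearCombination ℝ v (a.mapDomain (· + (i : ℤ)) - a)‖ := by
    rw [← norm_neg (Finsupp.linearCombination ℝ v _), ← map_neg, neg_sub,
      ← sq_le_sq₀ (norm_nonneg _) (norm_nonneg _), @norm_sub_sq ℂ, ← @inner_self_eq_norm_sq ℂ,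
      ← @inner_self_eq_norm_sq ℂ]
    simp only [inner_toLp_piChar hν, sub_self, map_zero, norm_zero, RCLike.re_eq_complex_re,
      Complex.ofReal_re]
    have h0 : Real.exp (-0 ^ 2 / 2) = 1 := by norm_num
    have := Real.add_one_le_exp
      (-‖Finsupp.linearCombination ℝ v (a - a.mapDomain (· + (i : ℤ)))‖ ^ 2 / 2)
    rw [h0]
    linarith
  have hdist (n : ℤ) (i : ℕ) : ‖v (n + i) - v n‖ = √(2 * (r 0 - r (i : ℤ))) := by
    rw [← Real.sqrt_sq (norm_nonneg (v (n + i) - v n)), norm_sub_sq_real, real_inner_comm,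
      ← real_inner_self_eq_norm_sq, ← real_inner_self_eq_norm_sq, hv, hv, hv]
    congr 1
    simp only [sub_self, add_sub_cancel_left]
    ring
  have hbound (i : ℕ) : ‖Finsupp.linearCombination ℝ v (a.mapDomain (· + (i : ℤ)) - a)‖ ≤
      ∑ n ∈ a.support, |a n| * √(2 * (r 0 - r (i : ℤ))) := by
    rw [map_sub, Finsupp.linearCombination_mapDomain]
    simp only [Finsupp.linearCombination_apply, Finsupp.sum, ← Finset.sum_sub_distrib, ← smul_sub,
      Function.comp_apply]
    refine (norm_sum_le _ _).trans_eq (Finset.sum_congr rfl fun n _ => ?_)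
    rw [norm_smul, Real.norm_eq_abs, hdist]
  have hlim : Tendsto (fun j => ∑ n ∈ a.support, |a n| * √(2 * (r 0 - r (ρ j : ℤ))))
      atTop (nhds 0) := by
    rw [show (0 : ℝ) = ∑ n ∈ a.support, 0 by simp]
    refine tendsto_finsetSum _ fun n _ => ?_
    have := (((hρ.const_sub (r 0)).const_mul 2).sqrt).const_mul |a n|
    simpa using this
  exact squeeze_zero (fun _ => norm_nonneg _) (fun j => (hle _).trans (hbound _)) hlim

end GaussianShift

/-- For every natural number `k ≥ 2` there exists a weak mixing invertible
measure-preserving transformation of a standard probability space for which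
`n ↦ k^n` is a rigidity sequence. -/
theorem weak_mixing_rigid_on_geometric (k : ℕ) (hk : 2 ≤ k) :
    ∃ (Y : Type) (mY : MeasurableSpace Y) (ν : Measure Y) (T : Y ≃ᵐ Y),
      StandardBorelSpace Y ∧ IsProbabilityMeasure ν ∧
      MeasurePreserving (⇑T) ν ν ∧ WeakMixing ν (⇑T) ∧
      RigiditySeq ν (⇑T) (fun n => k ^ n) := by
  obtain ⟨H, _, _, v, r, hv, hr, hρ⟩ := exists_stationary_rigid k hk
  obtain ⟨ν, hprob, hν⟩ := exists_gaussian_measure v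
  exact ⟨ℤ → ℝ, inferInstance, ν, coordinateShift, inferInstance, hprob,
    measurePreserving_coordinateShift hv hν, weakMixing_coordinateShift hv hν hr,
    rigiditySeq_coordinateShift hv hν hρ⟩
end

section
/- Let (X,B,μ) be a probability space and (C_n)_{n≥1} measurable sets with Σ_{n=1}^{∞} μ(C_n) = ∞. For k < n set V_k^n = X \ ⋃_{j=k}^{n−1} C_j, and suppose that for all k < n, μ(C_n ∩ V_k^n) ≥ (1/4) μ(C_n) μ(V_k^n). Then for every k, μ(V_k^{k+n}) ≤ ∏_{i=0}^{n−1} (1 − (1/4) μ(C_{k+i})) for all n ≥ 1, hence lim_{n→∞} μ(V_k^n) = 0 and μ(⋂_{k=1}^{∞} ⋃_{n=k}^{∞} C_n) = 1. -/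
open MeasureTheory Filter
open scoped ENNReal

/-- Every tail of a divergent series of extended nonnegative reals diverges, provided all its
terms are finite. -/
lemma ENNReal.tsum_add_eq_top {f : ℕ → ℝ≥0∞} (hf : ∀ n, f n ≠ ⊤) (hsum : ∑' n, f n = ⊤) (k : ℕ) :
    ∑' n, f (k + n) = ⊤ := by
  have h := ENNReal.summable.sum_add_tsum_nat_add' (f := f) (k := k)
  rw [hsum, ENNReal.add_eq_top] at h
  simpa only [add_comm k] using h.resolve_left (ENNReal.sum_ne_top.2 fun i _ => hf i)

/-- If `c n * v n` is at most the decrease of `v` at `n`, then the total decrease is at most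
`v 0`. -/
lemma ENNReal.sum_mul_add_le {c v : ℕ → ℝ≥0∞} (h : ∀ n, c n * v n + v (n + 1) ≤ v n) (n : ℕ) :
    ∑ i ∈ Finset.range n, c i * v i + v n ≤ v 0 := by
  induction n with
  | zero => simp
  | succ n ih =>
    rw [Finset.sum_range_succ, add_assoc]
    exact (add_le_add_right (h n) _).trans ih

/-- A constant lower bound for `v` vanishes when `v` decreases by at least `c n * v n` at each step
and `∑ c n` diverges. -/
lemma ENNReal.eq_zero_of_forall_le_of_tsum_eq_top {c v : ℕ → ℝ≥0∞} {L : ℝ≥0∞}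
    (h : ∀ n, c n * v n + v (n + 1) ≤ v n) (hv : v 0 ≠ ⊤) (hc : ∑' n, c n = ⊤)
    (hL : ∀ n, L ≤ v n) : L = 0 := by
  by_contra hL0
  have hle : ∑' n, c n * L ≤ v 0 := by
    refine ENNReal.tsum_le_of_sum_range_le fun n => ?_
    calc ∑ i ∈ Finset.range n, c i * L ≤ ∑ i ∈ Finset.range n, c i * v i := by
          gcongr with i; exact hL i
      _ ≤ v 0 := le_self_add.trans (ENNReal.sum_mul_add_le h n)
  rw [ENNReal.tsum_mul_right, hc, ENNReal.top_mul hL0, top_le_iff] at hle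
  exact hv hle

/-- If `v` decreases by at least `c n * v n` at each step, it is bounded by `v 0` times the
product of the factors `1 - c i`. -/
lemma ENNReal.le_mul_prod_one_sub {c v : ℕ → ℝ≥0∞} (h : ∀ n, c n * v n + v (n + 1) ≤ v n)
    (hv : ∀ n, v n ≠ ⊤) (hc : ∀ n, c n ≠ ⊤) (n : ℕ) :
    v n ≤ v 0 * ∏ i ∈ Finset.range n, (1 - c i) := by
  induction n with
  | zero => simp
  | succ n ih =>
    rw [Finset.prod_range_succ, ← mul_assoc]
    calc v (n + 1) ≤ v n - c n * v n :=
          ENNReal.le_sub_of_add_le_left (ENNReal.mul_ne_top (hc n) (hv n)) (h n)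
      _ = v n * (1 - c n) := by
          rw [ENNReal.mul_sub fun _ _ => hv n, mul_one, mul_comm (c n)]
      _ ≤ _ := by gcongr

/-- Borel–Cantelli type lemma for the switching sets: if `Σ μ(C_n) = ∞` and each `C_n`
is nearly independent of `V_k^n = (⋃_{j=k}^{n-1} C_j)ᶜ` in the sense that
`μ(C_n ∩ V_k^n) ≥ (1/4) μ(C_n) μ(V_k^n)`, then
`μ(V_k^{k+n}) ≤ ∏_{i<n} (1 − (1/4)μ(C_{k+i}))`, hence `μ(V_k^n) → 0` and almost every
point lies in infinitely many `C_n`. -/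
theorem switching_sets_cover
    {X : Type*} [MeasurableSpace X] (μ : Measure X) [IsProbabilityMeasure μ]
    (C : ℕ → Set X) (hC : ∀ n, MeasurableSet (C n))
    (hdiv : (∑' n : ℕ, μ (C n)) = ⊤)
    (V : ℕ → ℕ → Set X) (hV : ∀ k n, V k n = (⋃ j ∈ Finset.Ico k n, C j)ᶜ)
    (hind : ∀ k n, k < n →
      (1 / 4 : ℝ≥0∞) * μ (C n) * μ (V k n) ≤ μ (C n ∩ V k n)) :
    (∀ k : ℕ, ∀ n : ℕ, 1 ≤ n →
      μ (V k (k + n)) ≤ ∏ i ∈ Finset.range n, (1 - (1 / 4 : ℝ≥0∞) * μ (C (k + i)))) ∧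
    (∀ k : ℕ, Tendsto (fun n : ℕ => μ (V k n)) atTop (nhds 0)) ∧
    μ (⋂ k : ℕ, ⋃ n : ℕ, ⋃ (_ : k ≤ n), C n) = 1 := by
  have hV_self (k : ℕ) : V k k = Set.univ := by simp [hV]
  have hV_succ (k n : ℕ) : V k (k + n + 1) = V k (k + n) \ C (k + n) := by
    ext x
    simp only [hV, Set.mem_compl_iff, Set.mem_iUnion, Finset.mem_Ico, Set.mem_sdiff]
    grind
  have hV_meas (k n : ℕ) : MeasurableSet (V k n) := by
    rw [hV]
    exact (Finset.measurableSet_biUnion _ fun j _ => hC j).compl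
  have hV_anti (k : ℕ) : Antitone (V k) := by
    intro m n hmn
    rw [hV, hV, Set.compl_subset_compl]
    exact Set.biUnion_subset_biUnion_left
      (Finset.coe_subset.2 (Finset.Ico_subset_Ico_right hmn))
  have hstep (k n : ℕ) : (1 / 4 : ℝ≥0∞) * μ (C (k + n)) * μ (V k (k + n)) + μ (V k (k + (n + 1)))
      ≤ μ (V k (k + n)) := by
    have hle : (1 / 4 : ℝ≥0∞) * μ (C (k + n)) * μ (V k (k + n))
        ≤ μ (C (k + n) ∩ V k (k + n)) := by
      rcases n.eq_zero_or_pos with rfl | hn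
      · simp only [add_zero, hV_self, measure_univ, mul_one, Set.inter_univ]
        exact mul_le_of_le_one_left' (by norm_num)
      · exact hind k (k + n) (by lia)
    calc _ ≤ μ (V k (k + n) ∩ C (k + n)) + μ (V k (k + n) \ C (k + n)) := by
          rw [Set.inter_comm, ← hV_succ]
          exact add_le_add_left hle _
      _ = _ := measure_inter_add_sdiff _ (hC _)
  have hc_top (n : ℕ) : (1 / 4 : ℝ≥0∞) * μ (C n) ≠ ⊤ :=
    ENNReal.mul_ne_top (by norm_num) (measure_ne_top μ _)
  have hc_sum : ∑' n, (1 / 4 : ℝ≥0∞) * μ (C n) = ⊤ := by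
    rw [ENNReal.tsum_mul_left, hdiv, ENNReal.mul_top (by norm_num)]
  have hnull (k : ℕ) : μ (⋂ n, V k n) = 0 :=
    ENNReal.eq_zero_of_forall_le_of_tsum_eq_top (hstep k) (measure_ne_top μ _)
      (ENNReal.tsum_add_eq_top hc_top hc_sum k)
      fun n => measure_mono (Set.iInter_subset _ (k + n))
  refine ⟨fun k n _ => ?_, fun k => ?_, ?_⟩
  · simpa [hV_self] using ENNReal.le_mul_prod_one_sub (hstep k) (fun n => measure_ne_top μ _)
      (fun n => hc_top (k + n)) n
  · rw [← hnull k]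
    exact tendsto_measure_iInter_atTop (fun n => (hV_meas k n).nullMeasurableSet) (hV_anti k)
      ⟨k, measure_ne_top μ _⟩
  · have hmeas : MeasurableSet (⋂ k : ℕ, ⋃ n : ℕ, ⋃ (_ : k ≤ n), C n) :=
      .iInter fun k => .iUnion fun n => .iUnion fun _ => hC n
    rw [← prob_compl_eq_zero_iff hmeas, Set.compl_iInter, measure_iUnion_null_iff]
    refine fun k => measure_mono_null (fun x hx => ?_) (hnull k)
    simp only [hV, Set.mem_compl_iff, Set.mem_iUnion, Set.mem_iInter, Finset.mem_Ico] at hx ⊢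
    grind
end
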